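/- Let T be a tree of diameter 5 with vertex set {v_1, ..., v_n}, where v_1 and v_2 are its two central vertices (the two adjacent vertices of eccentricity 3), and let s_1, ..., s_n be integers with s_i ≥ 2 for all i. If s_1 ≥ 3 or s_2 ≥ 3, then d̄(T(s_1, ..., s_n)) = 5; that is, T(s_1, ..., s_n) belongs to class C_0. -/

import Mathlib

open SimpleGraph

variable {V : Type*}

/-- `D` is an orientation of `G`: every arc of `D` is an edge of `G`, and every edge of `G`
receives exactly one of the two possible directions. -/
def IsOrientation (G : SimpleGraph V) (D : V → V → Prop) : Prop :=
  (∀ u v, D u v → G.Adj u v) ∧ ∀ u v, G.Adj u v → (D u v ↔ ¬ D v u)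

/-- There is a directed walk of length `n` from `u` to `v` in the digraph `D`. -/
def DPath (D : V → V → Prop) : ℕ → V → V → Prop
  | 0, u, v => u = v
  | n + 1, u, v => ∃ w, D u w ∧ DPath D n w v

/-- Directed distance from `u` to `v` (`⊤` if `v` is not reachable from `u`). -/
noncomputable def ddist (D : V → V → Prop) (u v : V) : ℕ∞ :=
  sInf {n : ℕ∞ | ∃ m : ℕ, n = (m : ℕ∞) ∧ DPath D m u v}

/-- Diameter of a digraph: supremum of directed distances over all ordered pairs. -/
noncomputable def odiam (D : V → V → Prop) : ℕ∞ :=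
  ⨆ u : V, ⨆ v : V, ddist D u v

/-- A strong orientation of `G`: an orientation in which every vertex is reachable
from every other vertex by a directed path. -/
def IsStrongOrientation (G : SimpleGraph V) (D : V → V → Prop) : Prop :=
  IsOrientation G D ∧ ∀ u v, ∃ m : ℕ, DPath D m u v

/-- The orientation number of `G`: minimum diameter over all strong orientations. -/
noncomputable def orientNum (G : SimpleGraph V) : ℕ∞ :=
  sInf {d : ℕ∞ | ∃ D : V → V → Prop, IsStrongOrientation G D ∧ d = odiam D}

/-- The vertex-multiplication `G(s)`: vertex `v` is replaced by `s v` copies, and copies of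
`v_i`, `v_j` are adjacent iff `v_i v_j` is an edge of `G` (whence `i ≠ j`). -/
def vertexMult (G : SimpleGraph V) (s : V → ℕ) : SimpleGraph (Σ v : V, Fin (s v)) where
  Adj x y := G.Adj x.1 y.1
  symm := ⟨fun _ _ h => G.symm.symm _ _ h⟩
  loopless := ⟨fun x h => G.loopless.irrefl x.1 h⟩

/-- Eccentricity of a vertex. -/
noncomputable def ecc (G : SimpleGraph V) (v : V) : ℕ∞ :=
  ⨆ u : V, G.edist v u

theorem DPath.trans {D : V → V → Prop} {m n : ℕ} {x y z : V} (hxy : DPath D m x y)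
    (hyz : DPath D n y z) : DPath D (m + n) x z := by
  induction m generalizing x with
  | zero => obtain rfl : x = y := hxy; simpa using hyz
  | succ m ih =>
    obtain ⟨w, hw, hwy⟩ := hxy
    rw [Nat.succ_add]
    exact ⟨w, hw, ih hwy⟩

theorem DPath.single {D : V → V → Prop} {x y : V} (h : D x y) : DPath D 1 x y :=
  ⟨y, h, rfl⟩

theorem edist_le_of_dpath {T : SimpleGraph V} {s : V → ℕ}
    {D : (Σ v : V, Fin (s v)) → (Σ v : V, Fin (s v)) → Prop}
    (hD : IsOrientation (vertexMult T s) D) {m : ℕ} {x y : Σ v : V, Fin (s v)}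
    (h : DPath D m x y) : T.edist x.1 y.1 ≤ m := by
  induction m generalizing x with
  | zero => obtain rfl : x = y := h; simp
  | succ m ih =>
    obtain ⟨w, hw, hwy⟩ := h
    have hadj : T.Adj x.1 w.1 := hD.1 _ _ hw
    calc T.edist x.1 y.1 ≤ T.edist x.1 w.1 + T.edist w.1 y.1 := SimpleGraph.edist_triangle
      _ ≤ 1 + m := add_le_add (SimpleGraph.edist_eq_one_iff_adj.2 hadj).le (ih hwy)
      _ = ((m + 1 : ℕ) : ℕ∞) := by push_cast; rw [add_comm]

theorem ediam_le_orientNum_vertexMult (T : SimpleGraph V) (s : V → ℕ) (hs : ∀ v, 0 < s v) :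
    T.ediam ≤ orientNum (vertexMult T s) := by
  refine le_sInf ?_
  rintro _ ⟨D, hD, rfl⟩
  rw [SimpleGraph.ediam_def]
  refine iSup_le fun p => ?_
  refine le_trans ?_ (le_iSup₂_of_le (⟨p.1, 0, hs _⟩ : Σ v : V, Fin (s v)) ⟨p.2, 0, hs _⟩ le_rfl)
  refine le_sInf ?_
  rintro _ ⟨m, rfl, h⟩
  exact edist_le_of_dpath hD.1 h

theorem orientNum_le_of_dpath {G : SimpleGraph V} {D : V → V → Prop} (hD : IsOrientation G D)
    {k : ℕ} (h : ∀ x y, ∃ m ≤ k, DPath D m x y) : orientNum G ≤ k := by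
  refine le_trans (sInf_le ⟨D, ⟨hD, fun x y => ?_⟩, rfl⟩) ?_
  · obtain ⟨m, -, hm⟩ := h x y
    exact ⟨m, hm⟩
  · refine iSup₂_le fun x y => ?_
    obtain ⟨m, hmk, hm⟩ := h x y
    exact le_trans (sInf_le ⟨m, rfl, hm⟩) (by exact_mod_cast hmk)

/-- Adjacency of the six layers of a tree of diameter 5: the central vertices are the layers
`0` and `1`, their other neighbours the layers `2` and `3`, and the remaining vertices the
layers `4` and `5`. -/
def LayerAdj (k l : Fin 6) : Prop :=
  (k, l) ∈ [((0 : Fin 6), (1 : Fin 6)), (1, 0), (0, 2), (2, 0), (1, 3), (3, 1), (2, 4), (4, 2),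
    (3, 5), (5, 3)]

instance : DecidableRel LayerAdj := fun _ _ => inferInstanceAs (Decidable (_ ∈ _))

/-- The digraph from which the orientation of the vertex-multiplication is pulled back. -/
def TemplateArc (a b : Fin 11) : Prop :=
  (a, b) ∈ [((0 : Fin 11), (5 : Fin 11)), (0, 6), (1, 3), (1, 4), (1, 6), (2, 3), (2, 4), (2, 5),
    (3, 0), (3, 7), (4, 0), (4, 8), (5, 1), (5, 9), (6, 2), (7, 4), (7, 10), (8, 3), (9, 6),
    (10, 8)]

instance : DecidableRel TemplateArc := fun _ _ => inferInstanceAs (Decidable (_ ∈ _))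

/-- The layer of a vertex of the template digraph. -/
def templateLayer : Fin 11 → Fin 6 := ![0, 0, 0, 1, 1, 2, 2, 3, 3, 4, 5]

/-- The template vertex represented by the `i`-th copy of a vertex in layer `k`. -/
def templateVertex (k : Fin 6) (i : ℕ) : Fin 11 :=
  ![if i = 0 then 0 else if i = 1 then 1 else 2, if i = 0 then 3 else 4, if i = 0 then 5 else 6,
    if i = 0 then 7 else 8, 9, 10] k

theorem templateLayer_templateVertex (k : Fin 6) (i : ℕ) :
    templateLayer (templateVertex k i) = k := by
  fin_cases k <;> simp only [templateVertex] <;> simp <;> (try split_ifs) <;> rfl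

theorem exists_templateVertex_eq (a : Fin 11) :
    ∃ i, i < (if templateLayer a = 0 then 3 else 2) ∧
      templateVertex (templateLayer a) i = a := by
  have h : ∃ i < 3, i < (if templateLayer a = 0 then 3 else 2) ∧
      templateVertex (templateLayer a) i = a := by
    revert a; decide
  obtain ⟨i, -, hi⟩ := h
  exact ⟨i, hi⟩

theorem templateArc_iff_not (a b : Fin 11) (h : LayerAdj (templateLayer a) (templateLayer b)) :
    TemplateArc a b ↔ ¬ TemplateArc b a := by
  revert a b; decide +kernel

theorem TemplateArc.layerAdj (a b : Fin 11) (h : TemplateArc a b) :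
    LayerAdj (templateLayer a) (templateLayer b) := by
  revert a b; decide +kernel

/-- Directed walks of length `n + 1` in the template whose vertices after the first one avoid
the outermost layers. -/
def Ascent : ℕ → Fin 11 → Fin 11 → Prop
  | 0, a, b => TemplateArc a b
  | n + 1, a, b => ∃ c, templateLayer c < 4 ∧ TemplateArc a c ∧ Ascent n c b

instance Ascent.decidable : ∀ n a b, Decidable (Ascent n a b)
  | 0, a, b => inferInstanceAs (Decidable (TemplateArc a b))
  | n + 1, a, b =>
    haveI := Ascent.decidable n
    inferInstanceAs (Decidable (∃ c, templateLayer c < 4 ∧ TemplateArc a c ∧ Ascent n c b))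

/-- Directed walks of length `1` or `2` in the template through the neighbours of the central
layers. -/
def Descent : ℕ → Fin 11 → Fin 11 → Prop
  | 1, a, b => TemplateArc a b
  | 2, a, b => ∃ c, 2 ≤ templateLayer c ∧ templateLayer c < 4 ∧ 4 ≤ templateLayer b ∧
      TemplateArc a c ∧ TemplateArc c b
  | _, _, _ => False

instance Descent.decidable : ∀ n a b, Decidable (Descent n a b)
  | 0, _, _ => inferInstanceAs (Decidable False)
  | 1, a, b => inferInstanceAs (Decidable (TemplateArc a b))
  | 2, a, b => inferInstanceAs (Decidable (∃ c, 2 ≤ templateLayer c ∧ templateLayer c < 4 ∧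
      4 ≤ templateLayer b ∧ TemplateArc a c ∧ TemplateArc c b))
  | _ + 3, _, _ => inferInstanceAs (Decidable False)

theorem exists_ascent_descent (a b : Fin 11) :
    (templateLayer b < 2 ∧ ∃ n < 5, Ascent n a b) ∨
    (templateLayer a < 2 ∧ ∃ d < 3, Descent d a b) ∨
    ∃ c, templateLayer c < 2 ∧ ∃ n < 4, ∃ d < 3, n + 1 + d ≤ 5 ∧ Ascent n a c ∧ Descent d c b := by
  revert a b; decide +kernel

/-- The layers of a tree whose two central vertices form the layers `0` and `1`. -/
structure IsLayering (T : SimpleGraph V) (layer : V → Fin 6) : Prop where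
  layerAdj_of_adj : ∀ v w, T.Adj v w → LayerAdj (layer v) (layer w)
  adj_of_layerAdj : ∀ v w, layer v < 2 → LayerAdj (layer v) (layer w) → T.Adj v w
  exists_adj : ∀ v k, k < 4 → LayerAdj (layer v) k → ∃ w, layer w = k ∧ T.Adj v w
  exists_layer : ∀ k, k < 2 → ∃ v, layer v = k

theorem LayerAdj.symm {k l : Fin 6} (h : LayerAdj k l) : LayerAdj l k := by
  revert k l; decide

section Multiplication

variable {T : SimpleGraph V} {layer : V → Fin 6} {s : V → ℕ}

/-- The template vertex of a vertex of the vertex-multiplication. -/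
def toTemplate (layer : V → Fin 6) (s : V → ℕ) (x : Σ v : V, Fin (s v)) : Fin 11 :=
  templateVertex (layer x.1) x.2

/-- The orientation of the vertex-multiplication pulled back from the template. -/
def pullbackArc (T : SimpleGraph V) (layer : V → Fin 6) (s : V → ℕ)
    (x y : Σ v : V, Fin (s v)) : Prop :=
  T.Adj x.1 y.1 ∧ TemplateArc (toTemplate layer s x) (toTemplate layer s y)

theorem templateLayer_toTemplate (x : Σ v : V, Fin (s v)) :
    templateLayer (toTemplate layer s x) = layer x.1 :=
  templateLayer_templateVertex _ _

theorem isOrientation_pullbackArc (hl : IsLayering T layer) :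
    IsOrientation (vertexMult T s) (pullbackArc T layer s) := by
  refine ⟨fun x y h => h.1, fun x y h => ?_⟩
  have hxy : T.Adj x.1 y.1 := h
  have := templateArc_iff_not (toTemplate layer s x) (toTemplate layer s y)
    (by simpa only [templateLayer_toTemplate] using hl.layerAdj_of_adj _ _ hxy)
  simp only [pullbackArc, hxy, hxy.symm, true_and, this]

theorem exists_copy (hs : ∀ v, 2 ≤ s v) (hs₀ : ∀ v, layer v = 0 → 3 ≤ s v) {v : V} {a : Fin 11}
    (ha : templateLayer a = layer v) : ∃ i : Fin (s v), toTemplate layer s ⟨v, i⟩ = a := by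
  obtain ⟨i, hi, h⟩ := exists_templateVertex_eq a
  rw [ha] at hi h
  refine ⟨⟨i, hi.trans_le ?_⟩, h⟩
  split_ifs with h₀
  exacts [hs₀ v h₀, hs v]

theorem pullbackArc_to_center (hl : IsLayering T layer) {x y : Σ v : V, Fin (s v)}
    (h : TemplateArc (toTemplate layer s x) (toTemplate layer s y)) (hy : layer y.1 < 2) :
    pullbackArc T layer s x y := by
  have := h.layerAdj
  simp only [templateLayer_toTemplate] at this
  exact ⟨(hl.adj_of_layerAdj _ _ hy this.symm).symm, h⟩

theorem pullbackArc_from_center (hl : IsLayering T layer) {x y : Σ v : V, Fin (s v)}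
    (h : TemplateArc (toTemplate layer s x) (toTemplate layer s y)) (hx : layer x.1 < 2) :
    pullbackArc T layer s x y := by
  have := h.layerAdj
  simp only [templateLayer_toTemplate] at this
  exact ⟨hl.adj_of_layerAdj _ _ hx this, h⟩

theorem dpath_of_ascent (hl : IsLayering T layer) (hs : ∀ v, 2 ≤ s v)
    (hs₀ : ∀ v, layer v = 0 → 3 ≤ s v) {n : ℕ} {x y : Σ v : V, Fin (s v)}
    (h : Ascent n (toTemplate layer s x) (toTemplate layer s y)) (hy : layer y.1 < 2) :
    DPath (pullbackArc T layer s) (n + 1) x y := by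
  induction n generalizing x with
  | zero => exact .single (pullbackArc_to_center hl h hy)
  | succ n ih =>
    obtain ⟨c, hc, hxc, hcy⟩ := h
    have hadj := hxc.layerAdj
    rw [templateLayer_toTemplate] at hadj
    obtain ⟨w, hw, hxw⟩ := hl.exists_adj _ _ hc hadj
    obtain ⟨i, rfl⟩ := exists_copy hs hs₀ hw.symm
    exact ⟨⟨w, i⟩, ⟨hxw, hxc⟩, ih hcy⟩

theorem dpath_of_descent (hl : IsLayering T layer) (hs : ∀ v, 2 ≤ s v)
    (hs₀ : ∀ v, layer v = 0 → 3 ≤ s v) {d : ℕ} {x y : Σ v : V, Fin (s v)}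
    (h : Descent d (toTemplate layer s x) (toTemplate layer s y)) (hx : layer x.1 < 2) :
    DPath (pullbackArc T layer s) d x y := by
  match d, h with
  | 1, h => exact .single (pullbackArc_from_center hl h hx)
  | 2, ⟨c, _, hc, _, hxc, hcy⟩ =>
    have hadj := hcy.layerAdj
    rw [templateLayer_toTemplate] at hadj
    obtain ⟨w, hw, hyw⟩ := hl.exists_adj _ _ hc hadj.symm
    obtain ⟨i, rfl⟩ := exists_copy hs hs₀ hw.symm
    exact DPath.trans (m := 1) (n := 1) (.single (pullbackArc_from_center hl hxc hx))
      (.single ⟨hyw.symm, hcy⟩)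

theorem exists_dpath_pullbackArc (hl : IsLayering T layer) (hs : ∀ v, 2 ≤ s v)
    (hs₀ : ∀ v, layer v = 0 → 3 ≤ s v) (x y : Σ v : V, Fin (s v)) :
    ∃ m ≤ 5, DPath (pullbackArc T layer s) m x y := by
  rcases exists_ascent_descent (toTemplate layer s x) (toTemplate layer s y) with
    ⟨hy, n, hn, h⟩ | ⟨hx, d, hd, h⟩ | ⟨c, hc, n, -, d, -, hnd, hxc, hcy⟩
  · rw [templateLayer_toTemplate] at hy
    exact ⟨n + 1, hn, dpath_of_ascent hl hs hs₀ h hy⟩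
  · rw [templateLayer_toTemplate] at hx
    exact ⟨d, by omega, dpath_of_descent hl hs hs₀ h hx⟩
  · obtain ⟨w, hw⟩ := hl.exists_layer _ hc
    obtain ⟨i, rfl⟩ := exists_copy hs hs₀ hw.symm
    rw [← hw] at hc
    exact ⟨n + 1 + d, hnd, (dpath_of_ascent hl hs hs₀ hxc hc).trans
      (dpath_of_descent hl hs hs₀ hcy hc)⟩

theorem orientNum_vertexMult_le_five (hl : IsLayering T layer) (hs : ∀ v, 2 ≤ s v)
    (hs₀ : ∀ v, layer v = 0 → 3 ≤ s v) : orientNum (vertexMult T s) ≤ 5 :=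
  orientNum_le_of_dpath (isOrientation_pullbackArc hl) (exists_dpath_pullbackArc hl hs hs₀)

end Multiplication

section Tree

variable {T : SimpleGraph V} {v₁ v₂ : V}

theorem eq_of_adj_of_dist_lt (hT : T.IsTree) (h₁₂ : T.Adj v₁ v₂) {v w : V} (hvw : T.Adj v w)
    (hv : T.dist v₁ v < T.dist v₂ v) (hw : T.dist v₂ w < T.dist v₁ w) : v = v₁ ∧ w = v₂ := by
  classical
  obtain ⟨p, hp⟩ := hT.connected.exists_walk_length_eq_dist v₁ v
  obtain ⟨q, hq⟩ := hT.connected.exists_walk_length_eq_dist v₂ w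
  have hp₂ : v₂ ∉ p.support := fun h => by
    have := (SimpleGraph.dist_le (p.dropUntil v₂ h)).trans (p.length_dropUntil_le_length h)
    omega
  have hq₁ : v₁ ∉ q.support := fun h => by
    have := (SimpleGraph.dist_le (q.dropUntil v₁ h)).trans (q.length_dropUntil_le_length h)
    omega
  have hb := SimpleGraph.isBridge_iff_forall_walk_mem_edges.1
    (SimpleGraph.isAcyclic_iff_forall_adj_isBridge.1 hT.isAcyclic h₁₂)
    (p.append (.cons hvw q.reverse))
  simp only [SimpleGraph.Walk.edges_append, SimpleGraph.Walk.edges_cons, List.mem_append,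
    List.mem_cons, SimpleGraph.Walk.edges_reverse, List.mem_reverse] at hb
  rcases hb with hb | hb | hb
  · exact absurd (p.snd_mem_support_of_mem_edges hb) hp₂
  · rcases Sym2.eq_iff.1 hb with ⟨rfl, rfl⟩ | ⟨rfl, rfl⟩
    · exact ⟨rfl, rfl⟩
    · exact absurd p.end_mem_support hp₂
  · exact absurd (q.fst_mem_support_of_mem_edges hb) hq₁

/-- The layer of `v`, determined by its distances to the central vertices `v₁` and `v₂`. -/
noncomputable def treeLayer (T : SimpleGraph V) (v₁ v₂ v : V) : Fin 6 :=
  if T.dist v₁ v < T.dist v₂ v then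
    if T.dist v₁ v = 0 then 0 else if T.dist v₁ v = 1 then 2 else 4
  else
    if T.dist v₂ v = 0 then 1 else if T.dist v₂ v = 1 then 3 else 5

theorem exists_adj_dist_add_one {v w : V} {n : ℕ} (h : T.dist v w = n + 1) :
    ∃ u, T.Adj w u ∧ T.dist v u = n := by
  obtain ⟨p, hp⟩ := SimpleGraph.exists_walk_of_dist_ne_zero (u := w) (v := v)
    (by rw [SimpleGraph.dist_comm, h]; exact n.succ_ne_zero)
  rw [SimpleGraph.dist_comm, h] at hp
  cases p with
  | nil => simp at hp
  | @cons _ u _ hu q =>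
    refine ⟨u, hu, ?_⟩
    have h₁ := SimpleGraph.dist_le q
    rw [SimpleGraph.dist_comm] at h₁
    have h₂ := hu.diff_dist_adj (u := v)
    simp only [SimpleGraph.Walk.length_cons] at hp
    omega

theorem isLayering_treeLayer (hT : T.IsTree) (h₁₂ : T.Adj v₁ v₂)
    (h₁ : ∀ v, T.dist v₁ v ≤ 3) (h₂ : ∀ v, T.dist v₂ v ≤ 3)
    (he₁ : ∃ v, T.dist v₁ v = 3) (he₂ : ∃ v, T.dist v₂ v = 3) :
    IsLayering T (treeLayer T v₁ v₂) := by
  have hd : ∀ v, T.dist v₁ v = T.dist v₂ v + 1 ∨ T.dist v₂ v = T.dist v₁ v + 1 := fun v => by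
    simpa only [SimpleGraph.dist_comm (u := v)] using hT.dist_eq_dist_add_one_of_adj v h₁₂
  have hz₁ : ∀ v, T.dist v₁ v = 0 ↔ v₁ = v := fun v => hT.connected.dist_eq_zero_iff
  have hz₂ : ∀ v, T.dist v₂ v = 0 ↔ v₂ = v := fun v => hT.connected.dist_eq_zero_iff
  have ho₁ : ∀ v, T.dist v₁ v = 1 ↔ T.Adj v₁ v := fun v => SimpleGraph.dist_eq_one_iff_adj
  have ho₂ : ∀ v, T.dist v₂ v = 1 ↔ T.Adj v₂ v := fun v => SimpleGraph.dist_eq_one_iff_adj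
  have hl : ∀ v, (treeLayer T v₁ v₂ v = 0 ↔ T.dist v₁ v = 0) ∧
      (treeLayer T v₁ v₂ v = 1 ↔ T.dist v₂ v = 0) ∧
      (treeLayer T v₁ v₂ v = 2 ↔ T.dist v₁ v = 1 ∧ T.dist v₂ v = 2) ∧
      (treeLayer T v₁ v₂ v = 3 ↔ T.dist v₂ v = 1 ∧ T.dist v₁ v = 2) ∧
      (treeLayer T v₁ v₂ v = 4 ↔ T.dist v₁ v = 2 ∧ T.dist v₂ v = 3) ∧
      (treeLayer T v₁ v₂ v = 5 ↔ T.dist v₂ v = 2 ∧ T.dist v₁ v = 3) := fun v => by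
    have hdv := hd v
    have h₁v := h₁ v
    have h₂v := h₂ v
    unfold treeLayer
    generalize T.dist v₁ v = a at hdv h₁v ⊢
    generalize T.dist v₂ v = b at hdv h₂v ⊢
    split_ifs <;> simp <;> omega
  have hcases : ∀ v, (treeLayer T v₁ v₂ v = 0 ∧ T.dist v₁ v = 0 ∧ T.dist v₂ v = 1) ∨
      (treeLayer T v₁ v₂ v = 1 ∧ T.dist v₁ v = 1 ∧ T.dist v₂ v = 0) ∨
      (treeLayer T v₁ v₂ v = 2 ∧ T.dist v₁ v = 1 ∧ T.dist v₂ v = 2) ∨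
      (treeLayer T v₁ v₂ v = 3 ∧ T.dist v₁ v = 2 ∧ T.dist v₂ v = 1) ∨
      (treeLayer T v₁ v₂ v = 4 ∧ T.dist v₁ v = 2 ∧ T.dist v₂ v = 3) ∨
      (treeLayer T v₁ v₂ v = 5 ∧ T.dist v₁ v = 3 ∧ T.dist v₂ v = 2) := fun v => by
    have hdv := hd v
    have h₁v := h₁ v
    have h₂v := h₂ v
    unfold treeLayer
    generalize T.dist v₁ v = a at hdv h₁v ⊢
    generalize T.dist v₂ v = b at hdv h₂v ⊢
    split_ifs <;> simp <;> omega
  have hparent₁ : ∀ v, T.dist v₁ v = 2 → T.dist v₂ v = 3 →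
      ∃ u, treeLayer T v₁ v₂ u = 2 ∧ T.Adj v u := by
    intro v hv₁ hv₂
    obtain ⟨u, hvu, hu⟩ := exists_adj_dist_add_one hv₁
    have := eq_of_adj_of_dist_lt hT h₁₂ hvu
    exact ⟨u, by grind, hvu⟩
  have hparent₂ : ∀ v, T.dist v₂ v = 2 → T.dist v₁ v = 3 →
      ∃ u, treeLayer T v₁ v₂ u = 3 ∧ T.Adj v u := by
    intro v hv₁ hv₂
    obtain ⟨u, hvu, hu⟩ := exists_adj_dist_add_one hv₁
    have := eq_of_adj_of_dist_lt hT h₁₂.symm hvu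
    exact ⟨u, by grind, hvu⟩
  obtain ⟨u₁, hu₁⟩ : ∃ u, treeLayer T v₁ v₂ u = 2 := by
    obtain ⟨v, hv⟩ := he₂
    obtain ⟨u, hu, -⟩ := hparent₁ v (by grind) hv
    exact ⟨u, hu⟩
  obtain ⟨u₂, hu₂⟩ : ∃ u, treeLayer T v₁ v₂ u = 3 := by
    obtain ⟨v, hv⟩ := he₁
    obtain ⟨u, hu, -⟩ := hparent₂ v (by grind) hv
    exact ⟨u, hu⟩
  constructor
  · intro v w hvw
    have h₁vw := hT.dist_eq_dist_add_one_of_adj v₁ hvw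
    have h₂vw := hT.dist_eq_dist_add_one_of_adj v₂ hvw
    have hc₁ : T.dist v₁ v < T.dist v₂ v → T.dist v₂ w < T.dist v₁ w →
        T.dist v₁ v = 0 ∧ T.dist v₂ w = 0 := fun hv hw => by
      obtain ⟨rfl, rfl⟩ := eq_of_adj_of_dist_lt hT h₁₂ hvw hv hw
      exact ⟨T.dist_self, T.dist_self⟩
    have hc₂ : T.dist v₁ w < T.dist v₂ w → T.dist v₂ v < T.dist v₁ v →
        T.dist v₁ w = 0 ∧ T.dist v₂ v = 0 := fun hw hv => by
      obtain ⟨rfl, rfl⟩ := eq_of_adj_of_dist_lt hT h₁₂ hvw.symm hw hv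
      exact ⟨T.dist_self, T.dist_self⟩
    rcases hcases v with ⟨h, h₁v, h₂v⟩ | ⟨h, h₁v, h₂v⟩ | ⟨h, h₁v, h₂v⟩ | ⟨h, h₁v, h₂v⟩ |
        ⟨h, h₁v, h₂v⟩ | ⟨h, h₁v, h₂v⟩ <;>
      rcases hcases w with ⟨h', h₁w, h₂w⟩ | ⟨h', h₁w, h₂w⟩ | ⟨h', h₁w, h₂w⟩ |
        ⟨h', h₁w, h₂w⟩ | ⟨h', h₁w, h₂w⟩ | ⟨h', h₁w, h₂w⟩ <;>
      rw [h, h'] <;> first | decide | omega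
  · intro v w hv hvw
    generalize hk : treeLayer T v₁ v₂ v = k at *
    generalize hm : treeLayer T v₁ v₂ w = m at *
    have : (k = 0 ∧ (m = 1 ∨ m = 2)) ∨ (k = 1 ∧ (m = 0 ∨ m = 3)) := by
      clear hk hm; revert k m; decide
    have := h₁₂.symm
    grind
  · intro v k hk hvk
    generalize hm : treeLayer T v₁ v₂ v = m at *
    have : (k = 0 ∧ (m = 1 ∨ m = 2)) ∨ (k = 1 ∧ (m = 0 ∨ m = 3)) ∨ (k = 2 ∧ (m = 0 ∨ m = 4)) ∨
        (k = 3 ∧ (m = 1 ∨ m = 5)) := by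
      clear hm; revert k m; decide
    have := h₁₂.symm
    grind [SimpleGraph.Adj.symm]
  · intro k hk
    obtain rfl | rfl : k = 0 ∨ k = 1 := by revert k; decide
    exacts [⟨v₁, (hl v₁).1.2 T.dist_self⟩, ⟨v₂, (hl v₂).2.1.2 T.dist_self⟩]

end Tree

theorem dist_le_and_exists_dist_eq_of_ecc_eq [Fintype V] {T : SimpleGraph V}
    (hT : T.Connected) {v : V} {n : ℕ}
    (h : ecc T v = n) : (∀ w, T.dist v w ≤ n) ∧ ∃ w, T.dist v w = n := by
  have hd : ∀ w, (T.dist v w : ℕ∞) = T.edist v w := fun w => (hT v w).coe_dist_eq_edist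
  refine ⟨fun w => ?_, ?_⟩
  · have : T.edist v w ≤ ecc T v := le_iSup (T.edist v) w
    rw [h, ← hd] at this
    exact_mod_cast this
  · obtain ⟨w, hw⟩ := T.exists_edist_eq_eccent_of_finite v
    refine ⟨w, ?_⟩
    have : T.edist v w = n := hw.trans h
    rw [← hd] at this
    exact_mod_cast this

theorem stmt6 [Fintype V] (T : SimpleGraph V) (hT : T.IsTree) (hdiam : T.ediam = 5)
    (v₁ v₂ : V) (hadj : T.Adj v₁ v₂) (hecc₁ : ecc T v₁ = 3) (hecc₂ : ecc T v₂ = 3)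
    (s : V → ℕ) (hs : ∀ v, 2 ≤ s v) (h : 3 ≤ s v₁ ∨ 3 ≤ s v₂) :
    orientNum (vertexMult T s) = 5 := by
  have key : ∀ w₁ w₂ : V, T.Adj w₁ w₂ → ecc T w₁ = 3 → ecc T w₂ = 3 → 3 ≤ s w₁ →
      orientNum (vertexMult T s) ≤ 5 := by
    intro w₁ w₂ hw h₁ h₂ h₃
    obtain ⟨h₁, he₁⟩ := dist_le_and_exists_dist_eq_of_ecc_eq hT.connected (n := 3) h₁
    obtain ⟨h₂, he₂⟩ := dist_le_and_exists_dist_eq_of_ecc_eq hT.connected (n := 3) h₂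
    refine orientNum_vertexMult_le_five (isLayering_treeLayer hT hw h₁ h₂ he₁ he₂) hs
      fun v hv => ?_
    have hv₀ : T.dist w₁ v = 0 := by
      unfold treeLayer at hv
      split_ifs at hv <;> first | assumption | exact absurd hv (by decide)
    rwa [← hT.connected.dist_eq_zero_iff.1 hv₀]
  refine le_antisymm ?_ (hdiam ▸ ediam_le_orientNum_vertexMult T s fun v => by
    have := hs v; omega)
  rcases h with h | h
  · exact key v₁ v₂ hadj hecc₁ hecc₂ h
  · exact key v₂ v₁ hadj.symm hecc₂ hecc₁ h
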